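/- arXiv:2411.16913 — 2 statements merged into one kernel-verified Lean document; each statement's English description precedes it below -/
import Mathlib

section
/- Let p : ℕ → ℝ be a non-degenerate discrete probability distribution, μ(p) = ⨆ i, p i, and let α, β > 0 with α ≠ 1 and β ≠ 1 be such that (fun i => (p i)^α) is summable. Then the Sharma–Mittal entropy satisfies H_SM(α,β,p) ≥ (μ(p)^{β-1} - 1)/(1-β) > 0. -/
open Real Filter Topology

/-- The supremum of a positive probability distribution on `ℕ` with all masses below one
is itself below one. -/
lemma iSup_lt_one_of_hasSum_one (p : ℕ → ℝ) (hp : ∀ i, 0 < p i ∧ p i < 1) (hsum : HasSum p 1) :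
    ⨆ i, p i < 1 := by
  refine lt_of_le_of_lt (ciSup_le fun i => ?_)
    (max_lt (hp 0).2 (sub_lt_self 1 (hp 0).1))
  rcases eq_or_ne i 0 with rfl | hi
  · exact le_max_left _ _
  · refine le_max_of_le_right ?_
    have h := sum_le_hasSum {i, 0} (fun j _ => (hp j).1.le) hsum
    rw [Finset.sum_pair hi] at h
    linarith

/-- The exponential of the Rényi entropy is at least the reciprocal of any upper bound
for the masses. -/
lemma inv_le_tsum_rpow_rpow (p : ℕ → ℝ) (hp : ∀ i, 0 < p i) (hsum : HasSum p 1)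
    {m : ℝ} (hm : ∀ i, p i ≤ m) {α : ℝ} (hα1 : α ≠ 1)
    (hsummable : Summable (fun i => (p i) ^ α)) :
    m⁻¹ ≤ (∑' i, (p i) ^ α) ^ (1 / (1 - α)) := by
  have hm0 : 0 < m := (hp 0).trans_le (hm 0)
  have hfac : ∀ i, p i ^ α = p i * p i ^ (α - 1) := fun i => by
    rw [rpow_sub_one (hp i).ne', mul_div_cancel₀ _ (hp i).ne']
  have hmul : HasSum (fun i => p i * m ^ (α - 1)) (m ^ (α - 1)) := by
    simpa using hsum.mul_right (m ^ (α - 1))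
  have hS : 0 < ∑' i, p i ^ α :=
    hsummable.tsum_pos (fun i => (rpow_pos_of_pos (hp i) α).le) 0 (rpow_pos_of_pos (hp 0) α)
  have hne : 1 - α ≠ 0 := sub_ne_zero.2 hα1.symm
  have hinv : m⁻¹ = (m ^ (α - 1)) ^ (1 / (1 - α)) := by
    rw [← rpow_mul hm0.le, ← rpow_neg_one]
    congr 1
    field_simp
    ring
  rw [hinv]
  rcases lt_or_gt_of_ne hα1 with h | h
  · refine rpow_le_rpow (rpow_pos_of_pos hm0 _).le (hasSum_le (fun i => ?_) hmul
      hsummable.hasSum) (one_div_pos.2 (by linarith)).le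
    rw [hfac]
    exact mul_le_mul_of_nonneg_left
      (rpow_le_rpow_of_nonpos (hp i) (hm i) (by linarith)) (hp i).le
  · refine rpow_le_rpow_of_nonpos hS (hasSum_le (fun i => ?_) hsummable.hasSum hmul)
      (one_div_neg.2 (by linarith)).le
    rw [hfac]
    exact mul_le_mul_of_nonneg_left
      (rpow_le_rpow (hp i).le (hm i) (by linarith)) (hp i).le

/-- lower bound and positivity for the Sharma–Mittal entropy of a
non-degenerate discrete probability distribution. -/
theorem sharmaMittal_entropy_lower_bound
    (p : ℕ → ℝ) (hp : ∀ i, 0 < p i ∧ p i < 1) (hsum : HasSum p 1)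
    (α β : ℝ) (hα : 0 < α) (hα1 : α ≠ 1) (hβ : 0 < β) (hβ1 : β ≠ 1)
    (hsummable : Summable (fun i => (p i) ^ α)) :
    (1 - β)⁻¹ * ((∑' i, (p i) ^ α) ^ ((1 - β) / (1 - α)) - 1) ≥
      ((⨆ i, p i) ^ (β - 1) - 1) / (1 - β) ∧
    0 < ((⨆ i, p i) ^ (β - 1) - 1) / (1 - β) := by
  have hle : ∀ i, p i ≤ ⨆ i, p i :=
    le_ciSup ⟨1, Set.forall_mem_range.2 fun i => (hp i).2.le⟩
  have hlt := iSup_lt_one_of_hasSum_one p hp hsum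
  have hT := inv_le_tsum_rpow_rpow p (fun i => (hp i).1) hsum hle hα1 hsummable
  have hS : 0 ≤ ∑' i, p i ^ α := tsum_nonneg fun i => (rpow_pos_of_pos (hp i).1 α).le
  have hexp : (∑' i, p i ^ α) ^ ((1 - β) / (1 - α)) =
      ((∑' i, p i ^ α) ^ (1 / (1 - α))) ^ (1 - β) := by
    rw [← rpow_mul hS, one_div_mul_eq_div]
  rw [hexp, ge_iff_le, div_eq_inv_mul]
  generalize (∑' i, p i ^ α) ^ (1 / (1 - α)) = T at hT
  have hm0 : 0 < ⨆ i, p i := (hp 0).1.trans_le (hle 0)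
  generalize ⨆ i, p i = m at *
  have hinv : m ^ (β - 1) = m⁻¹ ^ (1 - β) := by
    rw [inv_rpow hm0.le, ← rpow_neg hm0.le, neg_sub]
  rcases lt_or_gt_of_ne hβ1 with h | h
  · have hc : 0 < (1 - β)⁻¹ := inv_pos.2 (by linarith)
    refine ⟨mul_le_mul_of_nonneg_left (sub_le_sub_right ?_ 1) hc.le, mul_pos hc (sub_pos.2 ?_)⟩
    · rw [hinv]
      exact rpow_le_rpow (inv_pos.2 hm0).le hT (by linarith)
    · exact one_lt_rpow_of_pos_of_lt_one_of_neg hm0 hlt (by linarith)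
  · have hc : (1 - β)⁻¹ < 0 := inv_lt_zero.2 (by linarith)
    refine ⟨mul_le_mul_of_nonpos_left (sub_le_sub_right ?_ 1) hc.le,
      mul_pos_of_neg_of_neg hc (sub_neg.2 ?_)⟩
    · rw [hinv]
      exact rpow_le_rpow_of_nonpos (inv_pos.2 hm0) hT (by linarith)
    · exact rpow_lt_one hm0.le hlt (by linarith)
end

section
/- For every α > 0 with α ≠ 1, the Rényi entropy of the Poisson distribution satisfies lim_{λ→∞} ( H_R(α,λ) - (1/2)·log(2πλ) ) = log α / (2(α-1)); in particular H_R(α,λ) → ∞ as λ → ∞. -/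
open Real Filter Topology

/-- The Poisson probabilities `p_i(λ) = e^{-λ} λ^i / i!`. -/
noncomputable def poissonP (l : ℝ) (i : ℕ) : ℝ :=
  Real.exp (-l) * l ^ i / (Nat.factorial i)

/-- `ψ(α,λ) = ∑_{i=0}^∞ (p_i(λ))^α`. -/
noncomputable def psiPoisson (α l : ℝ) : ℝ :=
  ∑' i, (poissonP l i) ^ α

open MeasureTheory in
theorem integrable_exp_neg_mul_abs {c : ℝ} (hc : 0 < c) :
    Integrable (fun x : ℝ => Real.exp (-c * |x|)) := by
  rw [← integrableOn_univ, ← Set.Iic_union_Ioi (a := (0 : ℝ))]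
  refine IntegrableOn.union ?_ ?_
  · refine (integrableOn_exp_mul_Iic hc 0).congr_fun (fun x hx => ?_) measurableSet_Iic
    simp only [abs_of_nonpos (Set.mem_Iic.1 hx)]
    ring_nf
  · refine (integrableOn_exp_mul_Ioi (neg_lt_zero.2 hc) 0).congr_fun (fun x hx => ?_)
      measurableSet_Ioi
    simp only [abs_of_pos (Set.mem_Ioi.1 hx)]

/-- The extension of a sequence to a right-continuous step function vanishing on `(-∞, 0)`. -/
noncomputable def stepFun (g : ℕ → ℝ) (t : ℝ) : ℝ :=
  if 0 ≤ t then g ⌊t⌋₊ else 0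

theorem measurable_stepFun (g : ℕ → ℝ) : Measurable (stepFun g) :=
  Measurable.ite measurableSet_Ici ((measurable_from_nat (f := g)).comp Nat.measurable_floor)
    measurable_const

open MeasureTheory in
theorem hasSum_integral_stepFun {g : ℕ → ℝ} (hg : Integrable (stepFun g)) :
    HasSum g (∫ t, stepFun g t) := by
  have hU : (⋃ i : ℕ, Set.Ico (i : ℝ) (i + 1)) = Set.Ici 0 := by
    ext t
    simp only [Set.mem_iUnion, Set.mem_Ico, Set.mem_Ici]
    exact ⟨fun ⟨i, hi, _⟩ => (Nat.cast_nonneg i).trans hi,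
      fun ht => ⟨⌊t⌋₊, Nat.floor_le ht, Nat.lt_floor_add_one t⟩⟩
  have hd : Pairwise (Function.onFun Disjoint fun i : ℕ => Set.Ico (i : ℝ) (i + 1)) := by
    intro i j hij
    refine Set.disjoint_left.2 fun t hi hj => hij ?_
    have ht : 0 ≤ t := (Nat.cast_nonneg i).trans hi.1
    rw [← (Nat.floor_eq_iff ht).2 hi, ← (Nat.floor_eq_iff ht).2 hj]
  have h := hasSum_integral_iUnion (f := stepFun g) (μ := volume)
    (fun i : ℕ => measurableSet_Ico) hd hg.integrableOn
  rw [hU, setIntegral_eq_integral_of_forall_compl_eq_zero (s := Set.Ici 0)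
    (fun t ht => show stepFun g t = 0 from if_neg ht)] at h
  convert! h using 2 with i
  have : Set.EqOn (stepFun g) (fun _ => g i) (Set.Ico (i : ℝ) (i + 1)) := by
    intro t ht
    have h0 : 0 ≤ t := (Nat.cast_nonneg i).trans ht.1
    simp only [stepFun, if_pos h0, (Nat.floor_eq_iff h0).2 ht]
  rw [setIntegral_congr_fun measurableSet_Ico this]
  simp

theorem poissonP_pos {l : ℝ} (hl : 0 < l) (n : ℕ) : 0 < poissonP l n := by
  unfold poissonP
  positivity

theorem poissonP_eq_succ {l : ℝ} (hl : 0 < l) (n : ℕ) :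
    poissonP l n = ((n + 1 : ℕ) : ℝ) / l * poissonP l (n + 1) := by
  unfold poissonP
  rw [Nat.factorial_succ]
  push_cast
  field_simp
  ring

theorem sqrt_mul_poissonP {l : ℝ} (hl : 0 < l) {n : ℕ} (hn : n ≠ 0) :
    √l * poissonP l n =
      √(l / n) / √2 / Stirling.stirlingSeq n * Real.exp (n - l + n * Real.log (l / n)) := by
  have hn' : (0 : ℝ) < n := by positivity
  have he : Real.exp (n - l + n * Real.log (l / n)) =
      Real.exp (-l) * l ^ n / ((n : ℝ) / Real.exp 1) ^ n := by
    rw [Real.exp_add, sub_eq_add_neg, Real.exp_add, mul_comm (n : ℝ) (Real.log _), Real.exp_mul,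
      Real.exp_log (by positivity), Real.rpow_natCast, ← Real.exp_one_pow, div_pow, div_pow]
    field_simp
  rw [he, Stirling.stirlingSeq, poissonP, Real.sqrt_div hl.le, Real.sqrt_mul (by norm_num)]
  have : ((n : ℝ) / Real.exp 1) ^ n ≠ 0 := by positivity
  have : √(n : ℝ) ≠ 0 := by positivity
  field_simp

theorem poisson_exponent_le {l j s : ℝ} (hl : 0 < l) (hj : 0 < j) (hs : |s| ≤ 1) :
    j - l + j * Real.log (l / j) ≤ l * s ^ 2 - (j - l) * s := by
  have h1 := Real.log_le_sub_one_of_pos (show 0 < l / j * Real.exp s by positivity)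
  rw [Real.log_mul (by positivity) (Real.exp_pos s).ne', Real.log_exp] at h1
  have h2 := (abs_le.1 (Real.abs_exp_sub_one_sub_id_le hs)).2
  have h3 := mul_le_mul_of_nonneg_left h1 hj.le
  have h4 : j * (l / j * Real.exp s - 1) = l * Real.exp s - j := by field_simp
  have h5 := mul_le_mul_of_nonneg_left h2 hl.le
  linarith

theorem poisson_exponent_le_abs {l j : ℝ} (hl : 1 ≤ l) (hj : 0 < j) :
    j - l + j * Real.log (l / j) ≤ 1 - |j - l| / √l := by
  have hl0 : 0 < l := by linarith
  have hs : 0 < √l := by positivity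
  have h1 : 1 / √l ≤ 1 := by
    rw [div_le_one hs]
    exact Real.one_le_sqrt.2 hl
  have h2 : l * (1 / √l) ^ 2 = 1 := by
    rw [div_pow, Real.sq_sqrt hl0.le]
    field_simp
  rcases le_total 0 (j - l) with h | h
  · have := poisson_exponent_le (s := 1 / √l) hl0 hj (by rwa [abs_of_pos (by positivity)])
    rw [h2] at this
    rw [abs_of_nonneg h, div_eq_mul_one_div (j - l)]
    exact this
  · have := poisson_exponent_le (s := -(1 / √l)) hl0 hj
      (by rwa [abs_neg, abs_of_pos (by positivity)])
    rw [neg_sq, h2] at this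
    rw [abs_of_nonpos h, div_eq_mul_one_div (-(j - l))]
    linarith

theorem sqrt_le_exp_abs {l j : ℝ} (hl : 1 ≤ l) :
    √(j / l) ≤ Real.exp (|j - l| / √l / 2) := by
  have hl0 : 0 < l := by linarith
  rw [Real.sqrt_le_left (by positivity), ← Real.exp_nat_mul]
  have h1 : j / l - 1 ≤ |j - l| / √l := by
    rw [← div_self hl0.ne', ← sub_div]
    refine (div_le_div_of_nonneg_right (le_abs_self _) hl0.le).trans ?_
    exact div_le_div_of_nonneg_left (abs_nonneg _) (by positivity)
      ((Real.sqrt_le_left hl0.le).2 (le_self_pow₀ hl two_ne_zero))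
  have h2 := Real.add_one_le_exp (|j - l| / √l)
  push_cast
  rw [mul_div_cancel₀ _ two_ne_zero]
  linarith

theorem sqrt_mul_poissonP_le {l : ℝ} (hl : 1 ≤ l) (n : ℕ) :
    √l * poissonP l n ≤ Real.exp (1 - |((n + 1 : ℕ) : ℝ) - l| / √l / 2) := by
  have hl0 : 0 < l := by linarith
  set j : ℝ := ((n + 1 : ℕ) : ℝ) with hj
  have hj0 : 0 < j := by positivity
  have hπ : 1 ≤ √2 * Stirling.stirlingSeq (n + 1) := by
    have h := Stirling.sqrt_pi_le_stirlingSeq n.succ_ne_zero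
    have h1 : 1 ≤ √π := Real.one_le_sqrt.2 (by linarith [Real.pi_gt_three])
    have h2 : 1 ≤ √2 := Real.one_le_sqrt.2 (by norm_num)
    exact one_le_mul_of_one_le_of_one_le h2 (h1.trans h)
  have hsq : j / l * √(l / j) = √(j / l) := by
    rw [← inv_div j l, Real.sqrt_inv]
    nth_rewrite 1 [← Real.mul_self_sqrt (show 0 ≤ j / l by positivity)]
    have : √(j / l) ≠ 0 := by positivity
    field_simp
  calc √l * poissonP l n = j / l * (√l * poissonP l (n + 1)) := by
        rw [poissonP_eq_succ hl0]; ring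
    _ = √(j / l) * Real.exp (j - l + j * Real.log (l / j)) /
          (√2 * Stirling.stirlingSeq (n + 1)) := by
        rw [sqrt_mul_poissonP hl0 n.succ_ne_zero, ← hj, ← hsq]
        ring
    _ ≤ √(j / l) * Real.exp (j - l + j * Real.log (l / j)) := div_le_self (by positivity) hπ
    _ ≤ Real.exp (|j - l| / √l / 2) * Real.exp (1 - |j - l| / √l) := by
        gcongr
        · exact sqrt_le_exp_abs hl
        · exact poisson_exponent_le_abs hl hj0
    _ = _ := by
        rw [← Real.exp_add]
        ring_nf

theorem sqrt_mul_poissonP_floor_le {l : ℝ} (hl : 1 ≤ l) {x : ℝ} (hx : 0 ≤ l + √l * x) :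
    √l * poissonP l ⌊l + √l * x⌋₊ ≤ Real.exp (3 / 2 - |x| / 2) := by
  refine (sqrt_mul_poissonP_le hl _).trans (Real.exp_le_exp.2 ?_)
  have hs : 1 ≤ √l := Real.one_le_sqrt.2 hl
  have h1 := Nat.floor_le hx
  have h2 := Nat.lt_floor_add_one (l + √l * x)
  have h3 : √l * |x| ≤ |((⌊l + √l * x⌋₊ + 1 : ℕ) : ℝ) - l| + 1 := by
    rw [← abs_of_nonneg (Real.sqrt_nonneg l), ← abs_mul, abs_of_nonneg (Real.sqrt_nonneg l)]
    push_cast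
    calc |√l * x| = |((⌊l + √l * x⌋₊ : ℝ) + 1 - l) + (l + √l * x - (⌊l + √l * x⌋₊ + 1))| := by
          ring_nf
      _ ≤ _ := (abs_add_le _ _).trans (by gcongr; rw [abs_le]; constructor <;> linarith)
  have h4 : |x| - 1 ≤ |((⌊l + √l * x⌋₊ + 1 : ℕ) : ℝ) - l| / √l := by
    rw [le_div_iff₀ (by positivity)]
    nlinarith
  linarith

theorem tendsto_poisson_exponent {n : ℝ → ℕ} {x : ℝ}
    (hn : Tendsto (fun l => ((n l : ℝ) - l) / √l) atTop (𝓝 x))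
    (hr : Tendsto (fun l => l / (n l : ℝ)) atTop (𝓝 1)) :
    Tendsto (fun l => (n l : ℝ) - l + n l * Real.log (l / n l)) atTop (𝓝 (-(x ^ 2 / 2))) := by
  have hn0 : ∀ᶠ l in atTop, n l ≠ 0 := by
    filter_upwards [hr.eventually_ne one_ne_zero] with l hl h
    simp [h] at hl
  have hw : Tendsto (fun l => 1 - l / (n l : ℝ)) atTop (𝓝 0) := by
    simpa using hr.const_sub 1
  have hw2 : Tendsto (fun l => (n l : ℝ) * (1 - l / (n l : ℝ)) ^ 2) atTop (𝓝 (x ^ 2)) := by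
    have := (hn.pow 2).mul hr
    rw [mul_one] at this
    refine this.congr' ?_
    filter_upwards [hn0, eventually_gt_atTop 0] with l h hl
    have : (n l : ℝ) ≠ 0 := by exact_mod_cast h
    rw [div_pow, Real.sq_sqrt hl.le]
    field_simp
  have hwa : Tendsto (fun l => |1 - l / (n l : ℝ)|) atTop (𝓝 0) := by simpa using hw.abs
  have hE : Tendsto (fun l => (n l : ℝ) * (1 - l / (n l : ℝ)) ^ 2 *
      (|1 - l / (n l : ℝ)| / (1 - |1 - l / (n l : ℝ)|))) atTop (𝓝 0) := by
    have := hw2.mul (hwa.div (hwa.const_sub 1) (by norm_num))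
    simpa using this
  have hR : Tendsto (fun l => (n l : ℝ) - l + n l * Real.log (l / n l) +
      (n l : ℝ) * (1 - l / (n l : ℝ)) ^ 2 / 2) atTop (𝓝 0) := by
    refine squeeze_zero_norm' ?_ hE
    filter_upwards [hn0, hwa.eventually_lt_const zero_lt_one] with l h hlt
    have h0 : (n l : ℝ) ≠ 0 := by exact_mod_cast h
    have hb := Real.abs_log_sub_add_sum_range_le hlt 2
    have hlog : 1 - (1 - l / (n l : ℝ)) = l / n l := by ring
    rw [hlog] at hb
    have hb' := mul_le_mul_of_nonneg_left hb (Nat.cast_nonneg (α := ℝ) (n l))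
    rw [← abs_of_nonneg (Nat.cast_nonneg (α := ℝ) (n l)), ← abs_mul,
      abs_of_nonneg (Nat.cast_nonneg (α := ℝ) (n l))] at hb'
    rw [Real.norm_eq_abs, ← sq_abs]
    convert! hb' using 1
    · congr 1
      simp only [Finset.sum_range_succ, Finset.sum_range_zero, sq_abs]
      have : (n l : ℝ) * (1 - l / n l) = n l - l := by field_simp
      push_cast
      linear_combination -this
    · ring
  have := hR.sub (hw2.div_const 2)
  rw [zero_sub] at this
  exact this.congr fun l => by ring

theorem tendsto_sqrt_mul_poissonP {n : ℝ → ℕ} {x : ℝ} (hninf : Tendsto n atTop atTop)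
    (hn : Tendsto (fun l => ((n l : ℝ) - l) / √l) atTop (𝓝 x)) :
    Tendsto (fun l => √l * poissonP l (n l)) atTop
      (𝓝 ((√(2 * π))⁻¹ * Real.exp (-(x ^ 2 / 2)))) := by
  have hr : Tendsto (fun l => l / (n l : ℝ)) atTop (𝓝 1) := by
    have h1 : Tendsto (fun l => 1 + ((n l : ℝ) - l) / √l / √l) atTop (𝓝 1) := by
      simpa using (hn.div_atTop Real.tendsto_sqrt_atTop).const_add 1
    have h2 := h1.inv₀ one_ne_zero
    rw [inv_one] at h2
    refine h2.congr' ?_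
    filter_upwards [eventually_gt_atTop 0] with l hl
    rw [div_div, Real.mul_self_sqrt hl.le, sub_div, div_self hl.ne', add_sub_cancel, inv_div]
  have hE := (Real.continuous_exp.tendsto _).comp (tendsto_poisson_exponent hn hr)
  have hS := Stirling.tendsto_stirlingSeq_sqrt_pi.comp hninf
  have hQ : Tendsto (fun l => √(l / (n l : ℝ))) atTop (𝓝 1) := by
    simpa using hr.sqrt
  have h := ((hQ.div_const √2).div hS (by positivity)).mul hE
  have hc : 1 / √2 / √π = (√(2 * π))⁻¹ := by
    rw [Real.sqrt_mul (by norm_num), mul_inv]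
    field_simp
  rw [hc] at h
  refine h.congr' ?_
  filter_upwards [eventually_gt_atTop 0, hninf.eventually_ne_atTop 0] with l hl hn
  exact (sqrt_mul_poissonP hl hn).symm

theorem tendsto_add_sqrt_mul_atTop (x : ℝ) : Tendsto (fun l : ℝ => l + √l * x) atTop atTop := by
  have h : Tendsto (fun l : ℝ => √l * (√l + x)) atTop atTop :=
    Real.tendsto_sqrt_atTop.atTop_mul_atTop₀
      (tendsto_atTop_add_const_right _ x Real.tendsto_sqrt_atTop)
  refine h.congr' ?_
  filter_upwards [eventually_ge_atTop 0] with l hl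
  rw [mul_add, Real.mul_self_sqrt hl]

theorem tendsto_sqrt_mul_poissonP_floor (x : ℝ) :
    Tendsto (fun l => √l * poissonP l ⌊l + √l * x⌋₊) atTop
      (𝓝 ((√(2 * π))⁻¹ * Real.exp (-(x ^ 2 / 2)))) := by
  refine tendsto_sqrt_mul_poissonP
    (tendsto_nat_floor_atTop.comp (tendsto_add_sqrt_mul_atTop x)) ?_
  have h0 : Tendsto (fun l : ℝ => x - 1 / √l) atTop (𝓝 x) := by
    simpa using Real.tendsto_sqrt_atTop.inv_tendsto_atTop.const_sub x
  refine tendsto_of_tendsto_of_tendsto_of_le_of_le' h0 tendsto_const_nhds ?_ ?_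
  · filter_upwards [eventually_gt_atTop 0] with l hl
    have hs : 0 < √l := by positivity
    rw [le_div_iff₀ hs, sub_mul, div_mul_cancel₀ _ hs.ne']
    linarith [Nat.lt_floor_add_one (l + √l * x)]
  · filter_upwards [eventually_gt_atTop 0,
      (tendsto_add_sqrt_mul_atTop x).eventually_ge_atTop 0] with l hl hx
    have hs : 0 < √l := by positivity
    rw [div_le_iff₀ hs]
    linarith [Nat.floor_le hx]

/-- The step function of `(√l * p_i(l)) ^ α`, centred at `l` and rescaled by `√l`. -/
noncomputable def rescaledPoisson (α l x : ℝ) : ℝ :=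
  stepFun (fun i => (√l * poissonP l i) ^ α) (l + √l * x)

theorem measurable_rescaledPoisson (α l : ℝ) : Measurable (rescaledPoisson α l) :=
  (measurable_stepFun _).comp (by fun_prop)

theorem norm_rescaledPoisson_le {α l : ℝ} (hα : 0 < α) (hl : 1 ≤ l) (x : ℝ) :
    ‖rescaledPoisson α l x‖ ≤ Real.exp (3 / 2 * α) * Real.exp (-(α / 2) * |x|) := by
  unfold rescaledPoisson stepFun
  split_ifs with hx
  · have hp : 0 ≤ √l * poissonP l ⌊l + √l * x⌋₊ :=
      mul_nonneg (Real.sqrt_nonneg l) (poissonP_pos (by linarith) _).le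
    rw [Real.norm_of_nonneg (by positivity)]
    refine (Real.rpow_le_rpow hp (sqrt_mul_poissonP_floor_le hl hx) hα.le).trans_eq ?_
    rw [← Real.exp_mul, ← Real.exp_add]
    ring_nf
  · rw [norm_zero]
    positivity

open MeasureTheory in
theorem integrable_rescaledPoisson {α l : ℝ} (hα : 0 < α) (hl : 1 ≤ l) :
    Integrable (rescaledPoisson α l) :=
  ((integrable_exp_neg_mul_abs (half_pos hα)).const_mul _).mono'
    (measurable_rescaledPoisson α l).aestronglyMeasurable
    (.of_forall (norm_rescaledPoisson_le hα hl))

open MeasureTheory in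
theorem integral_rescaledPoisson {α l : ℝ} (hα : 0 < α) (hl : 1 ≤ l) :
    ∫ x, rescaledPoisson α l x = (√l)⁻¹ * (√l ^ α * psiPoisson α l) := by
  have hs : 0 < √l := Real.sqrt_pos.2 (by linarith)
  set g : ℕ → ℝ := fun i => (√l * poissonP l i) ^ α
  have hint : Integrable (stepFun g) := by
    have h := integrable_rescaledPoisson hα hl
    have h1 : Integrable fun t => stepFun g (l + t) :=
      (integrable_comp_mul_left_iff (fun t => stepFun g (l + t)) hs.ne').1 h
    simpa using h1.comp_add_left (-l)
  have h1 : ∫ x, rescaledPoisson α l x = (√l)⁻¹ * ∫ t, stepFun g t := by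
    have := Measure.integral_comp_mul_left (fun t => stepFun g (l + t)) √l
    rw [integral_add_left_eq_self, abs_of_pos (by positivity), smul_eq_mul] at this
    exact this
  rw [h1, ← (hasSum_integral_stepFun hint).tsum_eq, psiPoisson,
    ← tsum_mul_left (a := √l ^ α)]
  refine congrArg _ (tsum_congr fun i => ?_)
  exact Real.mul_rpow hs.le (poissonP_pos (by linarith) i).le

open MeasureTheory in
theorem tendsto_integral_rescaledPoisson {α : ℝ} (hα : 0 < α) :
    Tendsto (fun l => ∫ x, rescaledPoisson α l x) atTop
      (𝓝 ((√(2 * π))⁻¹ ^ α * √(2 * π / α))) := by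
  have hlim : ∫ x : ℝ, ((√(2 * π))⁻¹ * Real.exp (-(x ^ 2 / 2))) ^ α =
      (√(2 * π))⁻¹ ^ α * √(2 * π / α) := by
    have h (x : ℝ) : ((√(2 * π))⁻¹ * Real.exp (-(x ^ 2 / 2))) ^ α =
        (√(2 * π))⁻¹ ^ α * Real.exp (-(α / 2) * x ^ 2) := by
      rw [Real.mul_rpow (by positivity) (by positivity), ← Real.exp_mul]
      ring_nf
    simp_rw [h]
    rw [integral_const_mul, integral_gaussian]
    congr 2
    field_simp
  rw [← hlim]
  refine tendsto_integral_filter_of_dominated_convergence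
    (fun x => Real.exp (3 / 2 * α) * Real.exp (-(α / 2) * |x|))
    (.of_forall fun l => (measurable_rescaledPoisson α l).aestronglyMeasurable) ?_
    ((integrable_exp_neg_mul_abs (half_pos hα)).const_mul _) (.of_forall fun x => ?_)
  · filter_upwards [eventually_ge_atTop 1] with l hl
    exact .of_forall (norm_rescaledPoisson_le hα hl)
  · refine ((tendsto_sqrt_mul_poissonP_floor x).rpow_const (Or.inr hα.le)).congr' ?_
    filter_upwards [(tendsto_add_sqrt_mul_atTop x).eventually_ge_atTop 0] with l hx
    simp only [rescaledPoisson, stepFun, if_pos hx]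

theorem tendsto_log_psiPoisson {α : ℝ} (hα : 0 < α) :
    Tendsto (fun l => Real.log (psiPoisson α l) - (1 - α) / 2 * Real.log (2 * π * l)) atTop
      (𝓝 (-(Real.log α / 2))) := by
  have hJ := tendsto_integral_rescaledPoisson hα
  have hL : 0 < (√(2 * π))⁻¹ ^ α * √(2 * π / α) := by positivity
  have hlog := (hJ.log hL.ne').sub_const ((1 - α) / 2 * Real.log (2 * π))
  have hv : Real.log ((√(2 * π))⁻¹ ^ α * √(2 * π / α)) - (1 - α) / 2 * Real.log (2 * π) =
      -(Real.log α / 2) := by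
    rw [Real.log_mul (by positivity) (by positivity), Real.log_rpow (by positivity), Real.log_inv,
      Real.log_sqrt (by positivity), Real.log_sqrt (by positivity),
      Real.log_div (by positivity) hα.ne']
    ring
  rw [hv] at hlog
  refine hlog.congr' ?_
  filter_upwards [eventually_ge_atTop 1, hJ.eventually_ne hL.ne'] with l hl hne
  have hl0 : 0 < l := by linarith
  have hs : 0 < √l := Real.sqrt_pos.2 hl0
  rw [integral_rescaledPoisson hα hl] at hne ⊢
  have hψ : psiPoisson α l ≠ 0 := fun h => hne (by rw [h, mul_zero, mul_zero])
  rw [Real.log_mul (by positivity) (mul_ne_zero (by positivity) hψ),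
    Real.log_mul (by positivity) hψ, Real.log_rpow hs, Real.log_inv, Real.log_sqrt hl0.le,
    Real.log_mul (by positivity) hl0.ne']
  ring

/-- asymptotics of the Rényi entropy of the Poisson distribution. -/
theorem renyi_poisson_asymptotic (α : ℝ) (hα : 0 < α) (hα1 : α ≠ 1) :
    Tendsto (fun l : ℝ => (1 - α)⁻¹ * Real.log (psiPoisson α l)
        - (1 / 2) * Real.log (2 * Real.pi * l))
      atTop (𝓝 (Real.log α / (2 * (α - 1)))) ∧
    Tendsto (fun l : ℝ => (1 - α)⁻¹ * Real.log (psiPoisson α l)) atTop atTop := by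
  have h1 : 1 - α ≠ 0 := sub_ne_zero.2 hα1.symm
  have h2 : α - 1 ≠ 0 := sub_ne_zero.2 hα1
  have hv : (1 - α)⁻¹ * -(Real.log α / 2) = Real.log α / (2 * (α - 1)) := by
    rw [← neg_sub α 1, inv_neg]
    field_simp
  have hlim : Tendsto (fun l : ℝ => (1 - α)⁻¹ * Real.log (psiPoisson α l)
      - (1 / 2) * Real.log (2 * Real.pi * l)) atTop (𝓝 (Real.log α / (2 * (α - 1)))) := by
    rw [← hv]
    refine ((tendsto_log_psiPoisson hα).const_mul (1 - α)⁻¹).congr fun l => ?_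
    field_simp
  refine ⟨hlim, ?_⟩
  have hlog : Tendsto (fun l : ℝ => 1 / 2 * Real.log (2 * Real.pi * l)) atTop atTop :=
    (Real.tendsto_log_atTop.comp (tendsto_id.const_mul_atTop (by positivity))).const_mul_atTop
      (by norm_num)
  exact (hlim.add_atTop hlog).congr fun l => sub_add_cancel _ _
end
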